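/- For every point x in X = supp(μ), the upper local dimension satisfies −log(1−q)/log B ≤ d̄(μ,x) ≤ −log q/log B. -/

import Mathlib

open MeasureTheory Filter Set Metric Topology

/-- `moranCyl c w n (x, ℓ)` refines the interval `[x, x + ℓ]` along the binary word `w`,
using the contraction ratio `c k` at step `k` (the first letter of `w` is processed with
index `n`).  The result `(x', ℓ')` describes the interval `[x', x' + ℓ']`. -/
noncomputable def moranCyl (c : ℕ → ℝ) : List Bool → ℕ → ℝ × ℝ → ℝ × ℝ
  | [], _, st => st
  | bb :: w, n, st =>
      moranCyl c w (n + 1)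
        (if bb then (st.1 + st.2 - st.2 / c n, st.2 / c n) else (st.1, st.2 / c n))

/-- The basic interval `I_w` of the Moran construction with ratios `c`. -/
noncomputable def moranI (c : ℕ → ℝ) (w : List Bool) : Set ℝ :=
  Icc (moranCyl c w 1 (0, 1)).1 ((moranCyl c w 1 (0, 1)).1 + (moranCyl c w 1 (0, 1)).2)

/-- The length `|I_w|` of the basic interval `I_w`. -/
noncomputable def moranLen (c : ℕ → ℝ) (w : List Bool) : ℝ :=
  (moranCyl c w 1 (0, 1)).2

/-- The Moran set `⋂ n ⋃ {I_w : |w| = n}`. -/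
noncomputable def moranSet (c : ℕ → ℝ) : Set ℝ :=
  ⋂ n : ℕ, ⋃ w ∈ {w : List Bool | w.length = n}, moranI c w

/-- The mass assigned to the cylinder `I_w` by the Moran measure with weight `r k` for the
letter at step `k`: `cylMass r w 1 1 = μ(I_w)`. -/
noncomputable def cylMass (r : ℕ → ℝ) : List Bool → ℕ → ℝ → ℝ
  | [], _, m => m
  | bb :: w, n, m => cylMass r w (n + 1) (if bb then (1 - r n) * m else r n * m)

/-- Lower local dimension `liminf_{r → 0⁺} log μ(B(x,r)) / log r`. -/
noncomputable def lowerLocalDim (μ : Measure ℝ) (x : ℝ) : ℝ :=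
  liminf (fun rr : ℝ => Real.log (μ (closedBall x rr)).toReal / Real.log rr) (𝓝[>] 0)

/-- Upper local dimension `limsup_{r → 0⁺} log μ(B(x,r)) / log r`. -/
noncomputable def upperLocalDim (μ : Measure ℝ) (x : ℝ) : ℝ :=
  limsup (fun rr : ℝ => Real.log (μ (closedBall x rr)).toReal / Real.log rr) (𝓝[>] 0)

/-- `betaFn ρ C s = -log (ρ^s + (1-ρ)^s) / log C`; so `β₁ = betaFn p A`, `β₂ = betaFn q B`. -/
noncomputable def betaFn (ρ C : ℝ) (s : ℝ) : ℝ :=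
  -Real.log (ρ ^ s + (1 - ρ) ^ s) / Real.log C

/-- The Legendre transform `f^*(α) = inf_s (s α - f(s))`. -/
noncomputable def legendre (f : ℝ → ℝ) (α : ℝ) : ℝ :=
  ⨅ s : ℝ, (s * α - f s)

/-- The modification `β̃₁` of `β₁`, linear on `(0,1)`. -/
noncomputable def betaTilde1 (ρ C : ℝ) (s : ℝ) : ℝ :=
  if s ≤ 0 ∨ 1 ≤ s then betaFn ρ C s
  else (1 - s) * betaFn ρ C 0 + s * betaFn ρ C 1

/-- `packSup μ X r s` is the supremum of `∑ᵢ μ(B(xᵢ,r))^s` over all finite families of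
pairwise disjoint closed balls of radius `r` with centers in `X`. -/
noncomputable def packSup (μ : Measure ℝ) (X : Set ℝ) (rr s : ℝ) : ℝ :=
  sSup {y : ℝ | ∃ t : Finset ℝ, (↑t : Set ℝ) ⊆ X ∧
    (↑t : Set ℝ).Pairwise (fun u v => Disjoint (closedBall u rr) (closedBall v rr)) ∧
    y = ∑ u ∈ t, (μ (closedBall u rr)).toReal ^ s}

/-- The common length of the level-`n` basic intervals. -/
noncomputable def levelLen (c : ℕ → ℝ) (n : ℕ) : ℝ :=
  ∏ k ∈ Finset.range n, (c (k + 1))⁻¹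

theorem moranCyl_append_singleton (c : ℕ → ℝ) (w : List Bool) (b : Bool) (n : ℕ) (st : ℝ × ℝ) :
    moranCyl c (w ++ [b]) n st = moranCyl c [b] (n + w.length) (moranCyl c w n st) := by
  induction w generalizing n st with
  | nil => simp [moranCyl]
  | cons a w ih =>
    simp only [List.cons_append, List.length_cons]
    rw [moranCyl, ih, moranCyl.eq_def c (a :: w)]
    simp only [show n + 1 + w.length = n + (w.length + 1) by ring]

theorem cylMass_append_singleton (r : ℕ → ℝ) (w : List Bool) (b : Bool) (n : ℕ) (m : ℝ) :
    cylMass r (w ++ [b]) n m = cylMass r [b] (n + w.length) (cylMass r w n m) := by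
  induction w generalizing n m with
  | nil => simp [cylMass]
  | cons a w ih =>
    simp only [List.cons_append, List.length_cons]
    rw [cylMass, ih, cylMass.eq_def r (a :: w)]
    simp only [show n + 1 + w.length = n + (w.length + 1) by ring]

theorem moranCyl_snd (c : ℕ → ℝ) (w : List Bool) :
    (moranCyl c w 1 (0, 1)).2 = levelLen c w.length := by
  induction w using List.reverseRecOn with
  | nil => simp [moranCyl, levelLen]
  | append_singleton w b ih =>
    rw [moranCyl_append_singleton, List.length_append, List.length_singleton, levelLen,
      Finset.prod_range_succ, ← levelLen, ← ih, add_comm 1]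
    cases b <;> simp [moranCyl, div_eq_mul_inv]

theorem moranI_eq (c : ℕ → ℝ) (w : List Bool) :
    moranI c w = Icc (moranCyl c w 1 (0, 1)).1
      ((moranCyl c w 1 (0, 1)).1 + levelLen c w.length) := by
  rw [moranI, moranCyl_snd]

theorem moranI_append_false (c : ℕ → ℝ) (w : List Bool) :
    moranI c (w ++ [false]) = Icc (moranCyl c w 1 (0, 1)).1
      ((moranCyl c w 1 (0, 1)).1 + levelLen c w.length / c (w.length + 1)) := by
  rw [moranI, moranCyl_append_singleton, add_comm 1, ← moranCyl_snd]
  simp [moranCyl]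

theorem moranI_append_true (c : ℕ → ℝ) (w : List Bool) :
    moranI c (w ++ [true]) = Icc ((moranCyl c w 1 (0, 1)).1 + levelLen c w.length
        - levelLen c w.length / c (w.length + 1))
      ((moranCyl c w 1 (0, 1)).1 + levelLen c w.length) := by
  rw [moranI, moranCyl_append_singleton, add_comm 1, ← moranCyl_snd]
  simp [moranCyl]

theorem cylMass_append_false (r : ℕ → ℝ) (w : List Bool) :
    cylMass r (w ++ [false]) 1 1 = r (w.length + 1) * cylMass r w 1 1 := by
  rw [cylMass_append_singleton, add_comm 1]; simp [cylMass]

theorem cylMass_append_true (r : ℕ → ℝ) (w : List Bool) :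
    cylMass r (w ++ [true]) 1 1 = (1 - r (w.length + 1)) * cylMass r w 1 1 := by
  rw [cylMass_append_singleton, add_comm 1]; simp [cylMass]

theorem levelLen_succ (c : ℕ → ℝ) (n : ℕ) :
    levelLen c (n + 1) = levelLen c n / c (n + 1) := by
  rw [levelLen, Finset.prod_range_succ, ← levelLen, div_eq_mul_inv]

theorem levelLen_pos {c : ℕ → ℝ} (hc : ∀ k, 0 < c (k + 1)) (n : ℕ) : 0 < levelLen c n :=
  Finset.prod_pos fun k _ => inv_pos.2 (hc k)

theorem neg_log_levelLen {c : ℕ → ℝ} (hc : ∀ k, 0 < c (k + 1)) (n : ℕ) :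
    -Real.log (levelLen c n) = ∑ k ∈ Finset.range n, Real.log (c (k + 1)) := by
  rw [levelLen, Real.log_prod fun k _ => (inv_pos.2 (hc k)).ne', ← Finset.sum_neg_distrib]
  simp [Real.log_inv]

theorem levelLen_le_pow {c : ℕ → ℝ} {B : ℝ} (hB : 0 < B) (hc : ∀ k, B ≤ c (k + 1)) (n : ℕ) :
    levelLen c n ≤ B⁻¹ ^ n := by
  rw [levelLen]
  calc _ ≤ ∏ k ∈ Finset.range n, B⁻¹ :=
        Finset.prod_le_prod (fun k _ => inv_nonneg.2 (hB.le.trans (hc k)))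
          fun k _ => inv_anti₀ hB (hc k)
    _ = _ := by simp

theorem tendsto_levelLen {c : ℕ → ℝ} {B : ℝ} (hB : 1 < B) (hc : ∀ k, B ≤ c (k + 1)) :
    Tendsto (levelLen c) atTop (𝓝 0) := by
  have hB0 : 0 < B := by linarith
  refine squeeze_zero (fun n => (levelLen_pos (fun k => hB0.trans_le (hc k)) n).le)
    (levelLen_le_pow hB0 hc) ?_
  exact tendsto_pow_atTop_nhds_zero_of_lt_one (inv_nonneg.2 hB0.le) (inv_lt_one_of_one_lt₀ hB)

theorem cylMass_pos {r : ℕ → ℝ} (hr0 : ∀ k, 0 < r (k + 1)) (hr1 : ∀ k, r (k + 1) ≤ 1 / 2)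
    (w : List Bool) : 0 < cylMass r w 1 1 := by
  induction w using List.reverseRecOn with
  | nil => simp [cylMass]
  | append_singleton w b ih =>
    have := hr0 w.length
    have := hr1 w.length
    cases b
    · rw [cylMass_append_false]; positivity
    · rw [cylMass_append_true]; exact mul_pos (by linarith) ih

theorem neg_log_cylMass_le {r : ℕ → ℝ} (hr0 : ∀ k, 0 < r (k + 1))
    (hr1 : ∀ k, r (k + 1) ≤ 1 / 2) (w : List Bool) :
    -Real.log (cylMass r w 1 1) ≤ ∑ k ∈ Finset.range w.length, -Real.log (r (k + 1)) := by
  induction w using List.reverseRecOn with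
  | nil => simp [cylMass]
  | append_singleton w b ih =>
    have h0 := hr0 w.length
    have h1 := hr1 w.length
    have hm := cylMass_pos hr0 hr1 w
    rw [List.length_append, List.length_singleton, Finset.sum_range_succ]
    cases b
    · rw [cylMass_append_false, Real.log_mul h0.ne' hm.ne']; linarith
    · rw [cylMass_append_true, Real.log_mul (by linarith) hm.ne']
      have := Real.log_le_log h0 (show r (w.length + 1) ≤ 1 - r (w.length + 1) by linarith)
      linarith

theorem le_neg_log_cylMass {r : ℕ → ℝ} (hr0 : ∀ k, 0 < r (k + 1))
    (hr1 : ∀ k, r (k + 1) ≤ 1 / 2) (w : List Bool) :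
    ∑ k ∈ Finset.range w.length, -Real.log (1 - r (k + 1)) ≤ -Real.log (cylMass r w 1 1) := by
  induction w using List.reverseRecOn with
  | nil => simp [cylMass]
  | append_singleton w b ih =>
    have h0 := hr0 w.length
    have h1 := hr1 w.length
    have hm := cylMass_pos hr0 hr1 w
    rw [List.length_append, List.length_singleton, Finset.sum_range_succ]
    cases b
    · rw [cylMass_append_false, Real.log_mul h0.ne' hm.ne']
      have := Real.log_le_log h0 (show r (w.length + 1) ≤ 1 - r (w.length + 1) by linarith)
      linarith
    · rw [cylMass_append_true, Real.log_mul (by linarith) hm.ne']; linarith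

/-- A ball centred in `I_w` with radius at least `|I_w|` contains `I_w`. -/
theorem moranI_subset_closedBall {c : ℕ → ℝ} {w : List Bool} {x ρ : ℝ} (hx : x ∈ moranI c w)
    (hρ : levelLen c w.length ≤ ρ) : moranI c w ⊆ closedBall x ρ := by
  rw [moranI_eq] at hx ⊢
  intro y hy
  rw [Real.closedBall_eq_Icc]
  constructor <;> linarith [hx.1, hx.2, hy.1, hy.2]

/-- A ball centred in `I_w`, too small to bridge any gap up to the level of `w`, has all of its
mass in `I_w`. -/
theorem measure_closedBall_le_inter_moranI {c r : ℕ → ℝ} {B : ℝ} (hB : 2 < B)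
    (hc : ∀ k, B ≤ c (k + 1)) (hr0 : ∀ k, 0 < r (k + 1)) (hr1 : ∀ k, r (k + 1) ≤ 1 / 2)
    (μ : Measure ℝ) [IsProbabilityMeasure μ]
    (hμ : ∀ w : List Bool, μ (moranI c w) = ENNReal.ofReal (cylMass r w 1 1)) {x ρ : ℝ}
    (w : List Bool) (hx : x ∈ moranI c w) (hρ : ρ < (1 - 2 / B) * levelLen c w.length) :
    μ (closedBall x ρ) ≤ μ (closedBall x ρ ∩ moranI c w) := by
  induction w using List.reverseRecOn with
  | nil =>
    have h1 : μ (moranI c []) = 1 := by rw [hμ]; simp [cylMass]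
    have h2 : μ (moranI c [])ᶜ = 0 := by
      rw [prob_compl_eq_zero_iff (by rw [moranI]; exact measurableSet_Icc)]; exact h1
    calc μ (closedBall x ρ) ≤ μ (closedBall x ρ ∩ moranI c []) + μ (closedBall x ρ \ moranI c []) :=
          measure_le_inter_add_sdiff _ _ _
      _ ≤ μ (closedBall x ρ ∩ moranI c []) + μ (moranI c [])ᶜ := by
          gcongr; exact fun y hy => hy.2
      _ = _ := by rw [h2, add_zero]
  | append_singleton w b ih =>
    have hcw := hc w.length
    have hcp : 0 < c (w.length + 1) := by linarith
    have hL := levelLen_pos (fun k => (by linarith [hc k] : 0 < c (k + 1))) w.length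
    have hδ : 0 < 1 - 2 / B := by
      rw [sub_pos, div_lt_one (by linarith)]; exact hB
    have hsl : levelLen c w.length / c (w.length + 1) ≤ levelLen c w.length :=
      div_le_self hL.le (by linarith)
    have hsl0 : 0 < levelLen c w.length / c (w.length + 1) := by positivity
    have hgap : levelLen c w.length - 2 * (levelLen c w.length / c (w.length + 1))
        ≥ (1 - 2 / B) * levelLen c w.length := by
      have : levelLen c w.length / c (w.length + 1) ≤ levelLen c w.length / B := by gcongr
      have e : (1 - 2 / B) * levelLen c w.length
        = levelLen c w.length - 2 * (levelLen c w.length / B) := by ring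
      rw [e]; linarith
    have hρ' : ρ < (1 - 2 / B) * levelLen c w.length := by
      refine hρ.trans_le ?_
      rw [List.length_append, List.length_singleton, levelLen_succ]
      gcongr
    have hgap0 := mul_pos hδ hL
    have hsub : ∀ b, moranI c (w ++ [b]) ⊆ moranI c w := by
      intro b
      cases b
      · rw [moranI_append_false, moranI_eq]; exact Icc_subset_Icc le_rfl (by linarith)
      · rw [moranI_append_true, moranI_eq]; exact Icc_subset_Icc (by linarith) le_rfl
    have hdisj : Disjoint (moranI c (w ++ [false])) (moranI c (w ++ [true])) := by
      rw [moranI_append_false, moranI_append_true, Set.disjoint_left]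
      intro y hy hy'
      linarith [hy.2, hy'.1]
    have hmeas : ∀ v, MeasurableSet (moranI c v) := fun v => by
      rw [moranI]; exact measurableSet_Icc
    have hnull : μ (moranI c w \ (moranI c (w ++ [false]) ∪ moranI c (w ++ [true]))) = 0 := by
      rw [measure_sdiff (union_subset (hsub _) (hsub _))
        ((hmeas _).union (hmeas _)).nullMeasurableSet (measure_ne_top _ _),
        measure_union hdisj (hmeas _), hμ, hμ, hμ, cylMass_append_false, cylMass_append_true]
      have hm := cylMass_pos hr0 hr1 w
      have h0 := hr0 w.length
      have h1 := hr1 w.length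
      rw [← ENNReal.ofReal_add (by positivity) (mul_nonneg (by linarith) hm.le), ← add_mul]
      simp
    have hball : closedBall x ρ ∩ moranI c w ⊆ (closedBall x ρ ∩ moranI c (w ++ [b])) ∪
        (moranI c w \ (moranI c (w ++ [false]) ∪ moranI c (w ++ [true]))) := by
      rintro y ⟨hy, hyw⟩
      by_cases h : y ∈ moranI c (w ++ [b])
      · exact Or.inl ⟨hy, h⟩
      refine Or.inr ⟨hyw, ?_⟩
      rw [Real.closedBall_eq_Icc] at hy
      cases b
      · rintro (h' | h')
        · exact h h'
        · rw [moranI_append_true] at h'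
          rw [moranI_append_false] at hx
          linarith [hx.2, h'.1, hy.2]
      · rintro (h' | h')
        · rw [moranI_append_true] at hx
          rw [moranI_append_false] at h'
          linarith [hx.1, h'.2, hy.1]
        · exact h h'
    calc μ (closedBall x ρ) ≤ μ (closedBall x ρ ∩ moranI c w) := ih (hsub b hx) hρ'
      _ ≤ _ := measure_mono hball
      _ ≤ _ := measure_union_le _ _
      _ = _ := by rw [hnull, add_zero]

theorem exists_mem_moranI {c : ℕ → ℝ} {x : ℝ} (hx : x ∈ moranSet c) (n : ℕ) :
    ∃ w : List Bool, w.length = n ∧ x ∈ moranI c w := by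
  simpa [moranSet] using mem_iInter.1 hx n

/-- Every positive index lies in one of the blocks `(N i, N (i + 1)]`. -/
theorem exists_block {N : ℕ → ℕ} (hN0 : N 0 = 0) (hN : StrictMono N) (k : ℕ) :
    ∃ i, N i < k + 1 ∧ k + 1 ≤ N (i + 1) := by
  have hex : ∃ j, k + 1 ≤ N j := ⟨k + 1, hN.id_le _⟩
  classical
  have hspec := Nat.find_spec hex
  rcases h : Nat.find hex with _ | i
  · rw [h, hN0] at hspec; omega
  · rw [h] at hspec
    exact ⟨i, not_le.1 (Nat.find_min hex (by omega)), hspec⟩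

theorem exists_levelLen_bracket {c : ℕ → ℝ} {B : ℝ} (hB : 1 < B) (hc : ∀ k, B ≤ c (k + 1))
    {ρ : ℝ} (h0 : 0 < ρ) (h1 : ρ < 1) : ∃ n, levelLen c (n + 1) ≤ ρ ∧ ρ < levelLen c n := by
  have hex : ∃ n, levelLen c n ≤ ρ :=
    ((tendsto_levelLen hB hc).eventually_le_const h0).exists
  classical
  have hspec := Nat.find_spec hex
  rcases h : Nat.find hex with _ | i
  · rw [h] at hspec; simp [levelLen] at hspec; linarith
  · rw [h] at hspec
    exact ⟨i, hspec, not_le.1 (Nat.find_min hex (by omega))⟩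

/-- Comparison of the mass of a ball with its radius. -/
theorem neg_log_measure_closedBall_le {c r : ℕ → ℝ} {A B D : ℝ} (hB : 2 < B)
    (hc : ∀ k, B ≤ c (k + 1)) (hcA : ∀ k, c (k + 1) ≤ A)
    (hr0 : ∀ k, 0 < r (k + 1)) (hr1 : ∀ k, r (k + 1) ≤ 1 / 2) (hD0 : 0 ≤ D)
    (hD : ∀ k, -Real.log (r (k + 1)) ≤ D * Real.log (c (k + 1)))
    (μ : Measure ℝ) [IsProbabilityMeasure μ]
    (hμ : ∀ w : List Bool, μ (moranI c w) = ENNReal.ofReal (cylMass r w 1 1)) {x : ℝ}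
    (hx : x ∈ moranSet c) {ρ : ℝ} (h0 : 0 < ρ) (h1 : ρ < 1) :
    0 < (μ (closedBall x ρ)).toReal ∧
      -Real.log (μ (closedBall x ρ)).toReal ≤ D * (-Real.log ρ + Real.log A) := by
  obtain ⟨n, hn, hn'⟩ := exists_levelLen_bracket (by linarith) hc h0 h1
  obtain ⟨w, hw, hxw⟩ := exists_mem_moranI hx (n + 1)
  have hm := cylMass_pos hr0 hr1 w
  have hcp : ∀ k, 0 < c (k + 1) := fun k => by linarith [hc k]
  have hle : cylMass r w 1 1 ≤ (μ (closedBall x ρ)).toReal := by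
    rw [← ENNReal.ofReal_le_iff_le_toReal (measure_ne_top _ _), ← hμ]
    exact measure_mono (moranI_subset_closedBall hxw (by rwa [hw]))
  refine ⟨hm.trans_le hle, ?_⟩
  calc -Real.log (μ (closedBall x ρ)).toReal ≤ -Real.log (cylMass r w 1 1) :=
        neg_le_neg (Real.log_le_log hm hle)
    _ ≤ ∑ k ∈ Finset.range (n + 1), -Real.log (r (k + 1)) := hw ▸ neg_log_cylMass_le hr0 hr1 w
    _ ≤ ∑ k ∈ Finset.range (n + 1), D * Real.log (c (k + 1)) :=
        Finset.sum_le_sum fun k _ => hD k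
    _ = D * (-Real.log (levelLen c n) + Real.log (c (n + 1))) := by
        rw [← Finset.mul_sum, Finset.sum_range_succ, neg_log_levelLen hcp]
    _ ≤ _ := by
        gcongr
        · exact hcp n
        · exact hcA n

theorem div_le_neg_log_quotient {b x Y X : ℝ} (hb : 0 ≤ b) (h : b ≤ -Real.log Y)
    (hX : 0 < -Real.log X) (hx : -Real.log X ≤ x) : b / x ≤ Real.log Y / Real.log X := by
  rw [← neg_div_neg_eq (Real.log Y)]
  exact div_le_div₀ (hb.trans h) h hX hx

/-- for every point x in X = supp(μ), the upper local dimension satisfies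
−log(1−q)/log B ≤ d̄(μ,x) ≤ −log q/log B. -/
theorem stmt_1 (A B p q : ℝ) (N : ℕ → ℕ)
    (hBA : B < A) (hB2 : 2 < B)
    (hp0 : 0 < p) (hp2 : p ≤ 1 / 2) (hq0 : 0 < q) (hq2 : q ≤ 1 / 2)
    (hN0 : N 0 = 0) (hNmono : StrictMono N)
    (hNlim : Tendsto (fun i : ℕ => (N (i + 1) : ℝ) / (N i : ℝ)) atTop atTop)
    (hpq : -Real.log p / Real.log A < -Real.log (1 - q) / Real.log B)
    (c r : ℕ → ℝ)
    (hcA : ∀ i n : ℕ, N (2 * i) < n → n ≤ N (2 * i + 1) → c n = A)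
    (hcB : ∀ i n : ℕ, N (2 * i + 1) < n → n ≤ N (2 * i + 2) → c n = B)
    (hrp : ∀ i n : ℕ, N (2 * i) < n → n ≤ N (2 * i + 1) → r n = p)
    (hrq : ∀ i n : ℕ, N (2 * i + 1) < n → n ≤ N (2 * i + 2) → r n = q)
    (μ : Measure ℝ) [IsProbabilityMeasure μ]
    (hμ : ∀ w : List Bool, μ (moranI c w) = ENNReal.ofReal (cylMass r w 1 1))
    (x : ℝ) (hx : x ∈ moranSet c) :
    -Real.log (1 - q) / Real.log B ≤ upperLocalDim μ x ∧
      upperLocalDim μ x ≤ -Real.log q / Real.log B := by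
  have hcr : ∀ k, (c (k + 1) = A ∧ r (k + 1) = p) ∨ (c (k + 1) = B ∧ r (k + 1) = q) := by
    intro k
    obtain ⟨i, h1, h2⟩ := exists_block hN0 hNmono k
    rcases Nat.even_or_odd' i with ⟨j, rfl | rfl⟩
    · exact Or.inl ⟨hcA j _ h1 h2, hrp j _ h1 h2⟩
    · exact Or.inr ⟨hcB j _ h1 h2, hrq j _ h1 h2⟩
  have hlogB : 0 < Real.log B := Real.log_pos (by linarith)
  have hlogA : 0 < Real.log A := Real.log_pos (by linarith)
  have hc : ∀ k, B ≤ c (k + 1) := fun k => by rcases hcr k with h | h <;> linarith [h.1]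
  have hcA' : ∀ k, c (k + 1) ≤ A := fun k => by rcases hcr k with h | h <;> linarith [h.1]
  have hcp : ∀ k, 0 < c (k + 1) := fun k => by linarith [hc k]
  have hr0 : ∀ k, 0 < r (k + 1) := fun k => by rcases hcr k with h | h <;> linarith [h.2]
  have hr1 : ∀ k, r (k + 1) ≤ 1 / 2 := fun k => by rcases hcr k with h | h <;> linarith [h.2]
  have hlogq : Real.log q ≤ Real.log (1 - q) := Real.log_le_log hq0 (by linarith)
  have hlogq1 : Real.log (1 - q) < 0 := Real.log_neg (by linarith) (by linarith)
  set D := -Real.log q / Real.log B with hDdef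
  have hD0 : 0 ≤ D := div_nonneg (by linarith) hlogB.le
  have hD : ∀ k, -Real.log (r (k + 1)) ≤ D * Real.log (c (k + 1)) := by
    intro k
    rcases hcr k with h | h <;> rw [h.1, h.2]
    · rw [← div_le_iff₀ hlogA]
      exact hpq.le.trans (by rw [hDdef]; gcongr)
    · rw [hDdef, div_mul_cancel₀ _ hlogB.ne']
  have key := fun {ρ : ℝ} => neg_log_measure_closedBall_le (ρ := ρ) hB2 hc hcA' hr0 hr1 hD0 hD μ hμ hx
  have hIoo : ∀ᶠ ρ : ℝ in 𝓝[>] 0, 0 < ρ ∧ ρ < 1 := Ioo_mem_nhdsGT one_pos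
  have hupper : ∀ᶠ ρ : ℝ in 𝓝[>] 0, Real.log (μ (closedBall x ρ)).toReal / Real.log ρ
      ≤ D * (1 + Real.log A / -Real.log ρ) := by
    filter_upwards [hIoo] with ρ hρ
    have hl : 0 < -Real.log ρ := neg_pos.2 (Real.log_neg hρ.1 hρ.2)
    rw [← neg_div_neg_eq, div_le_iff₀ hl]
    refine (key hρ.1 hρ.2).2.trans_eq ?_
    rw [mul_assoc, add_mul, one_mul, div_mul_cancel₀ _ hl.ne']
  have hlower : ∀ᶠ ρ : ℝ in 𝓝[>] 0,
      0 ≤ Real.log (μ (closedBall x ρ)).toReal / Real.log ρ := by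
    filter_upwards [hIoo] with ρ hρ
    exact div_nonneg_of_nonpos (Real.log_nonpos ENNReal.toReal_nonneg measureReal_le_one)
      (Real.log_neg hρ.1 hρ.2).le
  have hneglog : Tendsto (fun ρ : ℝ => -Real.log ρ) (𝓝[>] 0) atTop :=
    tendsto_neg_atBot_atTop.comp Real.tendsto_log_nhdsGT_zero
  have hlim : Tendsto (fun ρ : ℝ => D * (1 + Real.log A / -Real.log ρ)) (𝓝[>] 0) (𝓝 D) := by
    simpa using ((hneglog.const_div_atTop (Real.log A)).const_add 1).const_mul D
  have hbdd : IsBoundedUnder (· ≤ ·) (𝓝[>] 0)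
      (fun ρ : ℝ => Real.log (μ (closedBall x ρ)).toReal / Real.log ρ) :=
    hlim.isBoundedUnder_le.mono_le hupper
  constructor
  · refine le_of_forall_lt fun a ha => lt_of_lt_of_le (exists_between ha).choose_spec.1 ?_
    set a' := (exists_between ha).choose
    have ha' : a' < -Real.log (1 - q) / Real.log B := (exists_between ha).choose_spec.2
    refine le_limsup_of_frequently_le ?_ hbdd
    have hδ : 0 < 1 - 2 / B := by
      rw [sub_pos, div_lt_one (by linarith)]; exact hB2
    set δ := (1 - 2 / B) / 2 with hδdef
    have hδ0 : 0 < δ := by positivity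
    have hδ1 : δ < 1 := by
      have : 0 < 2 / B := by positivity
      rw [hδdef]; linarith
    have hidx : Tendsto (fun i => 2 * i + 1) atTop (atTop : Filter ℕ) :=
      tendsto_atTop_mono (fun i => by simp only [id]; omega) tendsto_id
    have hρlim : Tendsto (fun i => δ * levelLen c (N (2 * i + 2))) atTop (𝓝[>] 0) := by
      refine tendsto_nhdsWithin_iff.2 ⟨?_, .of_forall fun i => mul_pos hδ0 (levelLen_pos hcp _)⟩
      have h := (tendsto_levelLen (by linarith) hc).comp
        (hNmono.tendsto_atTop.comp ((tendsto_add_atTop_nat 1).comp hidx))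
      simpa using h.const_mul δ
    refine hρlim.frequently (Eventually.frequently ?_)
    have hratio : Tendsto (fun i => (N (2 * i + 1) : ℝ) / ((N (2 * i + 2) : ℝ) - N (2 * i + 1)))
        atTop (𝓝 0) := by
      have h := (tendsto_atTop_add_const_right _ (-1 : ℝ)
        (hNlim.comp hidx)).inv_tendsto_atTop
      refine h.congr fun i => ?_
      have h1 : 0 < N (2 * i + 1) := by
        have := hNmono (show 0 < 2 * i + 1 by omega); omega
      have h1' : (0 : ℝ) < N (2 * i + 1) := by exact_mod_cast h1
      simp only [Pi.inv_apply, Function.comp]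
      rw [show (N (2 * i + 1 + 1) : ℝ) / N (2 * i + 1) + -1
        = ((N (2 * i + 2) : ℝ) - N (2 * i + 1)) / N (2 * i + 1) by field_simp; ring, inv_div]
    have hg : Tendsto (fun i => -Real.log (1 - q) / (Real.log B +
        (N (2 * i + 1) : ℝ) / ((N (2 * i + 2) : ℝ) - N (2 * i + 1)) *
          (Real.log A - Real.log δ))) atTop (𝓝 (-Real.log (1 - q) / Real.log B)) := by
      have h := (hratio.mul_const (Real.log A - Real.log δ)).const_add (Real.log B)
      rw [zero_mul, add_zero] at h
      exact tendsto_const_nhds.div h hlogB.ne'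
    filter_upwards [hg.eventually_const_lt ha', hρlim.eventually hIoo] with i hi hρ
    refine hi.le.trans ?_
    obtain ⟨w, hw, hxw⟩ := exists_mem_moranI hx (N (2 * i + 2))
    have hL := levelLen_pos hcp (N (2 * i + 2))
    have hN1 : 1 ≤ N (2 * i + 1) := by
      have := hNmono (show 0 < 2 * i + 1 by omega); omega
    have hN1' : (1 : ℝ) ≤ N (2 * i + 1) := by exact_mod_cast hN1
    have hN2 : N (2 * i + 1) < N (2 * i + 2) := hNmono (by omega)
    have hN2' : (0 : ℝ) < (N (2 * i + 2) : ℝ) - N (2 * i + 1) := by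
      rw [sub_pos]; exact_mod_cast hN2
    have hcast : ((N (2 * i + 2) - N (2 * i + 1) : ℕ) : ℝ)
        = (N (2 * i + 2) : ℝ) - N (2 * i + 1) := Nat.cast_sub hN2.le
    have hmass : (μ (closedBall x (δ * levelLen c (N (2 * i + 2))))).toReal
        ≤ cylMass r w 1 1 := by
      refine ENNReal.toReal_le_of_le_ofReal (cylMass_pos hr0 hr1 w).le ?_
      rw [← hμ]
      refine (measure_closedBall_le_inter_moranI hB2 hc hr0 hr1 μ hμ w hxw ?_).trans
        (measure_mono inter_subset_right)
      rw [hw]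
      exact mul_lt_mul_of_pos_right (by rw [hδdef]; linarith) hL
    have hnum : ((N (2 * i + 2) : ℝ) - N (2 * i + 1)) * -Real.log (1 - q)
        ≤ -Real.log (μ (closedBall x (δ * levelLen c (N (2 * i + 2))))).toReal := by
      refine le_trans ?_ (neg_le_neg (Real.log_le_log (key hρ.1 hρ.2).1 hmass))
      refine le_trans ?_ (le_neg_log_cylMass hr0 hr1 w)
      rw [hw, ← Finset.sum_range_add_sum_Ico _ hN2.le]
      have h1 : 0 ≤ ∑ k ∈ Finset.range (N (2 * i + 1)), -Real.log (1 - r (k + 1)) :=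
        Finset.sum_nonneg fun k _ => neg_nonneg.2
          (Real.log_nonpos (by linarith [hr1 k]) (by linarith [hr0 k]))
      have h2 : ∑ k ∈ Finset.Ico (N (2 * i + 1)) (N (2 * i + 2)), -Real.log (1 - r (k + 1))
          = ((N (2 * i + 2) : ℝ) - N (2 * i + 1)) * -Real.log (1 - q) := by
        rw [Finset.sum_congr rfl fun k hk => by
          rw [hrq i (k + 1) (by have := Finset.mem_Ico.1 hk; omega)
            (by have := Finset.mem_Ico.1 hk; omega)]]
        rw [Finset.sum_const, Nat.card_Ico, nsmul_eq_mul, hcast]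
      linarith
    have hlogδ : Real.log δ < 0 := Real.log_neg hδ0 hδ1
    have hden : -Real.log (δ * levelLen c (N (2 * i + 2))) ≤
        ((N (2 * i + 2) : ℝ) - N (2 * i + 1)) * Real.log B +
          N (2 * i + 1) * (Real.log A - Real.log δ) := by
      rw [Real.log_mul hδ0.ne' hL.ne', neg_add, neg_log_levelLen hcp,
        ← Finset.sum_range_add_sum_Ico _ hN2.le]
      have h1 : ∑ k ∈ Finset.range (N (2 * i + 1)), Real.log (c (k + 1))
          ≤ N (2 * i + 1) * Real.log A := by
        refine (Finset.sum_le_card_nsmul _ _ (Real.log A) fun k _ =>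
          Real.log_le_log (hcp k) (hcA' k)).trans_eq ?_
        simp
      have h2 : ∑ k ∈ Finset.Ico (N (2 * i + 1)) (N (2 * i + 2)), Real.log (c (k + 1))
          = ((N (2 * i + 2) : ℝ) - N (2 * i + 1)) * Real.log B := by
        rw [Finset.sum_congr rfl fun k hk => by
          rw [hcB i (k + 1) (by have := Finset.mem_Ico.1 hk; omega)
            (by have := Finset.mem_Ico.1 hk; omega)]]
        rw [Finset.sum_const, Nat.card_Ico, nsmul_eq_mul, hcast]
      nlinarith
    refine le_trans (le_of_eq ?_) (div_le_neg_log_quotient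
      (mul_nonneg hN2'.le (by linarith)) hnum (neg_pos.2 (Real.log_neg hρ.1 hρ.2)) hden)
    rw [← mul_div_mul_left _ _ hN2'.ne']
    congr 1
    field_simp
  · refine (limsup_le_limsup hupper ?_ hlim.isBoundedUnder_le).trans_eq hlim.limsup_eq
    exact (isBoundedUnder_of_eventually_ge hlower).isCoboundedUnder_le
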